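/- Let ι be a type, and for each i ∈ ι let J_i be a small filtered category and F_i : J_i ⥤ Type u a functor. Then the product category ∏_{i∈ι} J_i is filtered, and the canonical map colim_{(j_i)_{i∈ι} ∈ ∏_i J_i} ∏_{i∈ι} F_i(j_i) → ∏_{i∈ι} colim_{j ∈ J_i} F_i(j), sending the class of a family (x_i)_{i∈ι} with x_i ∈ F_i(j_i) to the family of classes ([x_i])_{i∈ι}, is a bijection. (The axiom (AB6) holds in the category of types: arbitrary products distribute over filtered colimits.) -/

import Mathlib

/-!
(AB6) holds in the category of types: for a family of filtered categories `J i` and functors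
`F i : J i ⥤ Type u`, the product category `∀ i, J i` is filtered and the canonical map
`colim_{(j i)_i} ∏ i, F i (j i) → ∏ i, colim_j F i j` is a bijection.
-/

open CategoryTheory CategoryTheory.Limits

universe u

namespace Stmt0

variable {ι : Type u} {J : ι → Type u} [∀ i, SmallCategory (J i)]

/-- The functor `(∀ i, J i) ⥤ Type u` sending a family of indices `j` to the product
`∀ i, F i (j i)`. -/
def prodFunctor (F : ∀ i, J i ⥤ Type u) : (∀ i, J i) ⥤ Type u where
  obj j := ∀ i, (F i).obj (j i)
  map f := ↾fun x => fun i => (F i).map (f i) (x i)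
  map_id j := by
    ext x i
    simp
  map_comp f g := by
    ext x i
    simp

/-- The canonical comparison map
`colim_{(j i)_i ∈ ∏ i, J i} ∏ i, F i (j i) → ∏ i, colim_{j ∈ J i} F i j`,
sending the class of a family `(x i)_i` with `x i ∈ F i (j i)` to the family of
classes `([x i])_i`. -/
noncomputable def canonicalMap (F : ∀ i, J i ⥤ Type u) :
    colimit (prodFunctor F) → ∀ i, colimit (F i) :=
  colimit.desc (prodFunctor F)
    { pt := ∀ i, colimit (F i)
      ι :=
        { app := fun j => ↾fun x i => colimit.ι (F i) (j i) (x i)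
          naturality := by
            intro j k f
            ext x
            funext i
            exact ConcreteCategory.congr_hom (colimit.w (F i) (f i)) (x i) } }

end Stmt0

open Stmt0 in
/-- (AB6) for the category of types: arbitrary products distribute over filtered colimits. -/
theorem ab6_types {ι : Type u} {J : ι → Type u} [∀ i, SmallCategory (J i)]
    [∀ i, IsFiltered (J i)] (F : ∀ i, J i ⥤ Type u) :
    IsFiltered (∀ i, J i) ∧ Function.Bijective (canonicalMap F) := by
  have key (j : ∀ i, J i) (x : ∀ i, (F i).obj (j i)) :
      canonicalMap F (colimit.ι (prodFunctor F) j x) = fun i => colimit.ι (F i) (j i) (x i) :=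
    ConcreteCategory.congr_hom (colimit.ι_desc (F := prodFunctor F) _ j) x
  refine ⟨inferInstance, fun a b hab => ?_, fun y => ?_⟩
  · obtain ⟨j, x, rfl⟩ := Types.jointly_surjective' a
    obtain ⟨k, y, rfl⟩ := Types.jointly_surjective' b
    replace hab := (key j x).symm.trans (hab.trans (key k y))
    have h (i : ι) : ∃ (l : J i) (f : j i ⟶ l) (g : k i ⟶ l),
        (F i).map f (x i) = (F i).map g (y i) :=
      (Types.FilteredColimit.colimit_eq_iff (F i)).mp (congrFun hab i)
    choose l f g h using h
    exact (Types.FilteredColimit.colimit_eq_iff (prodFunctor F)).mpr ⟨l, f, g, funext h⟩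
  · choose j x h using fun i => Types.jointly_surjective' (F := F i) (y i)
    exact ⟨colimit.ι (prodFunctor F) j x, (key j x).trans (funext h)⟩
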